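/- arXiv:1910.09305 — 3 statements merged into one kernel-verified Lean document; each statement's English description precedes it below -/
import Mathlib

section
/- Fix integers imax, kmax ≥ 1, nonnegative constants a_1,…,a_{imax}, a threshold q* > 0, a parameter β ∈ (0,1], prescribed continuous inflow data q_{i,0} : [0,∞) → ℝ for each i, and prescribed initial data q_{i,k}(0) ∈ ℝ for i = 1,…,imax and k = 1,…,kmax. Then the augmented system of ordinary differential equations q̇_{i,k}(t) = F_{i,k-1}(t) − F_{i,k}(t) (k = 1,…,kmax), İ_i(t) = F_{i,0}(t), where F_{i,k} = a_i v1(v2(q_{i,k}, Q_{i+1,k} − Q_{i,k} + q_{i,k}, Q_{i−1,k} − Q_{i,k} + q_{i,k}; β); q*), Q_{i,k}(t) = I_i(t) + Σ_{j=1}^{kmax} q_{i,j}(0) − Σ_{j=1}^{k−1} q_{i,j}(t), indices i ± 1 taken modulo imax, and I_i(0) = 0, has a unique solution (q_{i,k}(t), I_i(t)) defined for all t ≥ 0, because the right-hand side is globally Lipschitz in the state variables. -/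
/-- Self-throttling function `v1(q; q*) = max{0, min{1, q/q*}}`. -/
noncomputable def v1 (q qstar : ℝ) : ℝ := max 0 (min 1 (q / qstar))

/-- Neighbor-throttling function
`v2(q, Δ⁺, Δ⁻; β) = min{q, (1/β)·max{Δ⁺, 0}, (1/β)·max{Δ⁻, 0}}`. -/
noncomputable def v2 (q Δp Δm β : ℝ) : ℝ :=
  min q (min ((1 / β) * max Δp 0) ((1 / β) * max Δm 0))

/-- `Q_{i,k}(t) = I_i(t) + ∑_{j=1}^{kmax} q_{i,j}(0) − ∑_{j=1}^{k−1} q_{i,j}(t)`, expressed in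
terms of the current state `(q, I)` and the prescribed initial data `qinit`; the stage index
`k ∈ {0, …, kmax}` is 1-based (stage `k` corresponds to the 0-based index `k − 1`). -/
noncomputable def Qfun {imax kmax : ℕ} (qinit : Fin imax → Fin kmax → ℝ)
    (q : Fin imax → Fin kmax → ℝ) (I : Fin imax → ℝ) (i : Fin imax) (k : ℕ) : ℝ :=
  I i + (∑ j, qinit i j)
    - ∑ j ∈ Finset.range (k - 1), (if h : j < kmax then q i ⟨j, h⟩ else 0)

/-- The amount of data sitting at (1-based) stage `k` of processor `i`: for `k = 0` it is the
prescribed inflow datum `q_{i,0}`, and for `1 ≤ k ≤ kmax` it is the state `q_{i,k}`. -/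
noncomputable def dataAt {imax kmax : ℕ} (qin : Fin imax → ℝ)
    (q : Fin imax → Fin kmax → ℝ) (i : Fin imax) (k : ℕ) : ℝ :=
  if k = 0 then qin i else if h : k - 1 < kmax then q i ⟨k - 1, h⟩ else 0

/-- The throughput
`F_{i,k} = a_i · v1(v2(q_{i,k}, Q_{i+1,k} − Q_{i,k} + q_{i,k}, Q_{i−1,k} − Q_{i,k} + q_{i,k}; β); q*)`,
with the processor indices `i ± 1` taken modulo `imax`. -/
noncomputable def Ffun {imax kmax : ℕ} [NeZero imax] (a : Fin imax → ℝ) (qstar β : ℝ)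
    (qinit : Fin imax → Fin kmax → ℝ) (qin : Fin imax → ℝ)
    (q : Fin imax → Fin kmax → ℝ) (I : Fin imax → ℝ) (i : Fin imax) (k : ℕ) : ℝ :=
  a i * v1 (v2 (dataAt qin q i k)
      (Qfun qinit q I (i + 1) k - Qfun qinit q I i k + dataAt qin q i k)
      (Qfun qinit q I (i - 1) k - Qfun qinit q I i k + dataAt qin q i k) β) qstar

/-- `(q, I)` is a solution of the augmented system
`q̇_{i,k} = F_{i,k−1} − F_{i,k}` (`k = 1, …, kmax`), `İ_i = F_{i,0}`, on `[0, ∞)`, with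
initial data `q(0) = qinit`, `I(0) = 0`, and prescribed inflow `qin`.  The 0-based index
`k : Fin kmax` represents the 1-based stage `k + 1`. -/
def IsSol {imax kmax : ℕ} [NeZero imax] (a : Fin imax → ℝ) (qstar β : ℝ)
    (qin : Fin imax → ℝ → ℝ) (qinit : Fin imax → Fin kmax → ℝ)
    (q : ℝ → Fin imax → Fin kmax → ℝ) (I : ℝ → Fin imax → ℝ) : Prop :=
  q 0 = qinit ∧ I 0 = 0 ∧
  (∀ t : ℝ, 0 ≤ t → ∀ i : Fin imax, ∀ k : Fin kmax,
    HasDerivWithinAt (fun s => q s i k)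
      (Ffun a qstar β qinit (fun j => qin j t) (q t) (I t) i k.val
        - Ffun a qstar β qinit (fun j => qin j t) (q t) (I t) i (k.val + 1))
      (Set.Ici 0) t) ∧
  (∀ t : ℝ, 0 ≤ t → ∀ i : Fin imax,
    HasDerivWithinAt (fun s => I s i)
      (Ffun a qstar β qinit (fun j => qin j t) (q t) (I t) i 0) (Set.Ici 0) t)

/-- `f` is Lipschitz with some constant. -/
def GloballyLipschitz {X Y : Type*} [PseudoEMetricSpace X] [PseudoEMetricSpace Y]
    (f : X → Y) : Prop :=
  ∃ K, LipschitzWith K f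

namespace GloballyLipschitz

variable {X : Type*} [PseudoEMetricSpace X] {f g : X → ℝ}

lemma const (c : ℝ) : GloballyLipschitz fun _ : X => c :=
  ⟨0, LipschitzWith.const c⟩

lemma add (hf : GloballyLipschitz f) (hg : GloballyLipschitz g) :
    GloballyLipschitz fun x => f x + g x :=
  let ⟨_, hf⟩ := hf
  let ⟨_, hg⟩ := hg
  ⟨_, hf.add hg⟩

lemma sub (hf : GloballyLipschitz f) (hg : GloballyLipschitz g) :
    GloballyLipschitz fun x => f x - g x :=
  let ⟨_, hf⟩ := hf
  let ⟨_, hg⟩ := hg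
  ⟨_, hf.sub hg⟩

lemma max (hf : GloballyLipschitz f) (hg : GloballyLipschitz g) :
    GloballyLipschitz fun x => Max.max (f x) (g x) :=
  let ⟨_, hf⟩ := hf
  let ⟨_, hg⟩ := hg
  ⟨_, hf.max hg⟩

lemma min (hf : GloballyLipschitz f) (hg : GloballyLipschitz g) :
    GloballyLipschitz fun x => Min.min (f x) (g x) :=
  let ⟨_, hf⟩ := hf
  let ⟨_, hg⟩ := hg
  ⟨_, hf.min hg⟩

lemma const_mul (c : ℝ) (hf : GloballyLipschitz f) :
    GloballyLipschitz fun x => c * f x :=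
  let ⟨_, hf⟩ := hf
  ⟨_, (lipschitzWith_smul c).comp hf⟩

lemma sum {ι : Type*} (s : Finset ι) {f : ι → X → ℝ} (hf : ∀ j, GloballyLipschitz (f j)) :
    GloballyLipschitz fun x => ∑ j ∈ s, f j x := by
  classical
  induction s using Finset.induction_on with
  | empty => simpa using const 0
  | insert j s hj ih => simpa [Finset.sum_insert hj] using (hf j).add ih

lemma pi {ι : Type*} [Fintype ι] {E : ι → Type*} [∀ j, PseudoEMetricSpace (E j)]
    {f : X → ∀ j, E j} (hf : ∀ j, GloballyLipschitz fun x => f x j) : GloballyLipschitz f := by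
  choose K hK using hf
  refine ⟨∑ j, K j, fun x y => edist_pi_le_iff.2 fun j => (hK j x y).trans ?_⟩
  gcongr
  exact Finset.single_le_sum (f := K) (fun _ _ => zero_le) (Finset.mem_univ j)

lemma prodMk {Y Z : Type*} [PseudoEMetricSpace Y] [PseudoEMetricSpace Z] {f : X → Y} {g : X → Z}
    (hf : GloballyLipschitz f) (hg : GloballyLipschitz g) :
    GloballyLipschitz fun x => (f x, g x) :=
  let ⟨_, hf⟩ := hf
  let ⟨_, hg⟩ := hg
  ⟨_, hf.prodMk hg⟩

end GloballyLipschitz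

section GlobalSolution

open scoped NNReal

variable {E : Type*} [NormedAddCommGroup E] [NormedSpace ℝ E]

lemma eqOn_Icc_of_hasDerivWithinAt_of_lipschitzWith {f : ℝ → E → E} {K : ℝ≥0}
    (hlip : ∀ t, LipschitzWith K (f t)) {a b : ℝ} {γ δ : ℝ → E}
    (hγ : ∀ t ∈ Set.Icc a b, HasDerivWithinAt γ (f t (γ t)) (Set.Icc a b) t)
    (hδ : ∀ t ∈ Set.Icc a b, HasDerivWithinAt δ (f t (δ t)) (Set.Icc a b) t)
    (h : γ a = δ a) : Set.EqOn γ δ (Set.Icc a b) :=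
  ODE_solution_unique hlip (fun t ht => (hγ t ht).continuousWithinAt)
    (fun t ht => (hγ t (Set.Ico_subset_Icc_self ht)).mono_of_mem_nhdsWithin
      (Icc_mem_nhdsGE_of_mem ht))
    (fun t ht => (hδ t ht).continuousWithinAt)
    (fun t ht => (hδ t (Set.Ico_subset_Icc_self ht)).mono_of_mem_nhdsWithin
      (Icc_mem_nhdsGE_of_mem ht)) h

/-- A bounded vector field that is continuous in time and uniformly Lipschitz in space has, for
each initial value, an integral curve on `[0, ∞)`. -/
lemma exists_forall_hasDerivWithinAt_Ici_of_lipschitzWith [CompleteSpace E] {f : ℝ → E → E}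
    {K L : ℝ≥0} (hlip : ∀ t, LipschitzWith K (f t)) (hcont : ∀ x, Continuous fun t => f t x)
    (hbound : ∀ t x, ‖f t x‖ ≤ L) (x₀ : E) :
    ∃ γ : ℝ → E, γ 0 = x₀ ∧
      ∀ t, 0 ≤ t → HasDerivWithinAt γ (f t (γ t)) (Set.Ici 0) t := by
  have hloc (n : ℕ) : ∃ γ : ℝ → E, γ 0 = x₀ ∧
      ∀ t ∈ Set.Icc (0 : ℝ) n, HasDerivWithinAt γ (f t (γ t)) (Set.Icc 0 (n : ℝ)) t := by
    have hpl : IsPicardLindelof f (⟨0, le_rfl, n.cast_nonneg⟩ : Set.Icc (0 : ℝ) n) x₀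
        (L * n) 0 L K :=
      { lipschitzOnWith := fun t _ => (hlip t).lipschitzOnWith
        continuousOn := fun x _ => (hcont x).continuousOn
        norm_le := fun t _ x _ => hbound t x
        mul_max_le := by simp }
    exact hpl.exists_eq_forall_mem_Icc_hasDerivWithinAt₀
  choose γ hγ0 hγ using hloc
  have heq {m n : ℕ} (hmn : m ≤ n) : Set.EqOn (γ m) (γ n) (Set.Icc 0 m) := by
    have hsub : Set.Icc (0 : ℝ) m ⊆ Set.Icc 0 n := Set.Icc_subset_Icc_right (mod_cast hmn)
    exact eqOn_Icc_of_hasDerivWithinAt_of_lipschitzWith hlip (hγ m)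
      (fun t ht => (hγ n t (hsub ht)).mono hsub) ((hγ0 m).trans (hγ0 n).symm)
  refine ⟨fun t => γ (⌊t⌋₊ + 1) t, hγ0 _, fun t ht => ?_⟩
  set n := ⌊t⌋₊ + 1
  have htn : t < (n : ℝ) := by simpa [n] using Nat.lt_floor_add_one t
  have hd : HasDerivWithinAt (γ n) (f t (γ n t)) (Set.Ici 0) t :=
    (hγ n t ⟨ht, htn.le⟩).mono_of_mem_nhdsWithin <| by
      filter_upwards [self_mem_nhdsWithin, mem_nhdsWithin_of_mem_nhds (Iio_mem_nhds htn)]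
        with s hs hsn using ⟨hs, le_of_lt hsn⟩
  refine hd.congr_of_eventuallyEq ?_ rfl
  filter_upwards [self_mem_nhdsWithin, mem_nhdsWithin_of_mem_nhds (Iio_mem_nhds htn)] with s hs hsn
  refine heq (Nat.succ_le_of_lt ((Nat.floor_lt hs).2 hsn)) ⟨hs, ?_⟩
  exact_mod_cast (Nat.lt_floor_add_one s).le

end GlobalSolution

section Throughput

variable {imax kmax : ℕ}

lemma v1_mem_Icc (q qstar : ℝ) : v1 q qstar ∈ Set.Icc (0 : ℝ) 1 :=
  ⟨le_max_left _ _, max_le zero_le_one (min_le_left _ _)⟩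

/-- The inflow values together with the state `(q, I)`. -/
abbrev InflowState (imax kmax : ℕ) : Type :=
  (Fin imax → ℝ) × (Fin imax → Fin kmax → ℝ) × (Fin imax → ℝ)

lemma globallyLipschitz_dataAt (i : Fin imax) (k : ℕ) :
    GloballyLipschitz fun z : InflowState imax kmax => dataAt z.1 z.2.1 i k := by
  unfold dataAt
  split_ifs
  · exact ⟨_, (LipschitzWith.eval i).comp LipschitzWith.prod_fst⟩
  · exact ⟨_, (LipschitzWith.eval _).comp ((LipschitzWith.eval i).comp
      (LipschitzWith.prod_fst.comp LipschitzWith.prod_snd))⟩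
  · exact .const 0

lemma globallyLipschitz_Qfun (qinit : Fin imax → Fin kmax → ℝ) (i : Fin imax) (k : ℕ) :
    GloballyLipschitz fun z : InflowState imax kmax => Qfun qinit z.2.1 z.2.2 i k := by
  have hI : GloballyLipschitz fun z : InflowState imax kmax => z.2.2 i :=
    ⟨_, (LipschitzWith.eval i).comp (LipschitzWith.prod_snd.comp LipschitzWith.prod_snd)⟩
  refine (hI.add (.const _)).sub (.sum _ fun j => ?_)
  split_ifs
  · exact ⟨_, (LipschitzWith.eval _).comp ((LipschitzWith.eval i).comp
      (LipschitzWith.prod_fst.comp LipschitzWith.prod_snd))⟩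
  · exact .const 0

variable [NeZero imax]

lemma globallyLipschitz_Ffun (a : Fin imax → ℝ) (qstar β : ℝ)
    (qinit : Fin imax → Fin kmax → ℝ) (i : Fin imax) (k : ℕ) :
    GloballyLipschitz fun z : InflowState imax kmax => Ffun a qstar β qinit z.1 z.2.1 z.2.2 i k := by
  have hd := globallyLipschitz_dataAt (kmax := kmax) i k
  have hQ := fun j => globallyLipschitz_Qfun qinit j k
  have hΔ (j : Fin imax) := ((((hQ j).sub (hQ i)).add hd).max (.const 0)).const_mul (1 / β)
  unfold Ffun v1 v2
  simp only [div_eq_inv_mul _ qstar]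
  exact ((GloballyLipschitz.const 0).max ((GloballyLipschitz.const 1).min
    ((hd.min ((hΔ (i + 1)).min (hΔ (i - 1)))).const_mul qstar⁻¹))).const_mul (a i)

lemma Ffun_mem_Icc {a : Fin imax → ℝ} (ha : ∀ i, 0 ≤ a i) (qstar β : ℝ)
    (qinit : Fin imax → Fin kmax → ℝ) (qin : Fin imax → ℝ) (q : Fin imax → Fin kmax → ℝ)
    (I : Fin imax → ℝ) (i : Fin imax) (k : ℕ) :
    Ffun a qstar β qinit qin q I i k ∈ Set.Icc 0 ‖a‖ := by
  have hv (x : ℝ) := v1_mem_Icc x qstar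
  refine ⟨mul_nonneg (ha i) (hv _).1, (mul_le_of_le_one_right (ha i) (hv _).2).trans ?_⟩
  exact (le_abs_self _).trans (norm_le_pi_norm a i)

/-- The right-hand side of the augmented system, as a function of inflow values and state. -/
noncomputable def augmentedField (a : Fin imax → ℝ) (qstar β : ℝ)
    (qinit : Fin imax → Fin kmax → ℝ) (z : InflowState imax kmax) :
    (Fin imax → Fin kmax → ℝ) × (Fin imax → ℝ) :=
  (fun i k => Ffun a qstar β qinit z.1 z.2.1 z.2.2 i k.val
      - Ffun a qstar β qinit z.1 z.2.1 z.2.2 i (k.val + 1),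
    fun i => Ffun a qstar β qinit z.1 z.2.1 z.2.2 i 0)

lemma globallyLipschitz_augmentedField (a : Fin imax → ℝ) (qstar β : ℝ)
    (qinit : Fin imax → Fin kmax → ℝ) : GloballyLipschitz (augmentedField a qstar β qinit) :=
  have hF := globallyLipschitz_Ffun a qstar β qinit
  .prodMk (.pi fun i => .pi fun k => (hF i k.val).sub (hF i (k.val + 1))) (.pi fun i => hF i 0)

lemma norm_augmentedField_le {a : Fin imax → ℝ} (ha : ∀ i, 0 ≤ a i) (qstar β : ℝ)
    (qinit : Fin imax → Fin kmax → ℝ) (z : InflowState imax kmax) :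
    ‖augmentedField a qstar β qinit z‖ ≤ ‖a‖ := by
  have hF := Ffun_mem_Icc ha qstar β qinit z.1 z.2.1 z.2.2
  refine norm_prod_le_iff.2 ⟨?_, ?_⟩
  · refine (pi_norm_le_iff_of_nonneg (norm_nonneg a)).2 fun i =>
      (pi_norm_le_iff_of_nonneg (norm_nonneg a)).2 fun k => abs_le.2 ?_
    have h₁ := hF i k.val
    have h₂ := hF i (k.val + 1)
    simp only [augmentedField]
    constructor <;> linarith [h₁.1, h₁.2, h₂.1, h₂.2]
  · refine (pi_norm_le_iff_of_nonneg (norm_nonneg a)).2 fun i => ?_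
    exact (abs_of_nonneg (hF i 0).1).trans_le (hF i 0).2

lemma isSol_iff {a : Fin imax → ℝ} {qstar β : ℝ} {qin : Fin imax → ℝ → ℝ}
    {qinit : Fin imax → Fin kmax → ℝ} {q : ℝ → Fin imax → Fin kmax → ℝ}
    {I : ℝ → Fin imax → ℝ} :
    IsSol a qstar β qin qinit q I ↔ (q 0, I 0) = (qinit, 0) ∧
      ∀ t, 0 ≤ t → HasDerivWithinAt (fun s => (q s, I s))
        (augmentedField a qstar β qinit (fun j => qin j t, q t, I t)) (Set.Ici 0) t := by
  rw [IsSol, Prod.mk.injEq, and_assoc]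
  refine and_congr_right fun _ => and_congr_right fun _ => ⟨fun h t ht => ?_, fun h => ?_⟩
  · exact (hasDerivWithinAt_pi.2 fun i => hasDerivWithinAt_pi.2 fun k => h.1 t ht i k).prodMk
      (hasDerivWithinAt_pi.2 fun i => h.2 t ht i)
  · refine ⟨fun t ht i k => ?_, fun t ht i => ?_⟩
    · exact hasDerivWithinAt_pi.1 (hasDerivWithinAt_pi.1 (h t ht).fst i) k
    · exact hasDerivWithinAt_pi.1 (h t ht).snd i

end Throughput

/-- For `imax, kmax ≥ 1`, nonnegative maximal throughputs `a_i`, threshold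
`q* > 0`, `β ∈ (0,1]`, prescribed continuous inflow data `q_{i,0}` and prescribed initial data
`q_{i,k}(0)`, the augmented system `q̇_{i,k} = F_{i,k−1} − F_{i,k}` (`k = 1, …, kmax`),
`İ_i = F_{i,0}`, with `Q_{i,k} = I_i + ∑_{j=1}^{kmax} q_{i,j}(0) − ∑_{j=1}^{k−1} q_{i,j}`,
indices `i ± 1` modulo `imax`, and `I_i(0) = 0`, has a unique solution `(q_{i,k}(t), I_i(t))`
defined for all `t ≥ 0` (the right-hand side being globally Lipschitz in the state). -/
theorem stmt0 {imax kmax : ℕ} [NeZero imax] (hkmax : 1 ≤ kmax)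
    (a : Fin imax → ℝ) (ha : ∀ i, 0 ≤ a i)
    (qstar : ℝ) (hqstar : 0 < qstar) (β : ℝ) (hβ : β ∈ Set.Ioc (0:ℝ) 1)
    (qin : Fin imax → ℝ → ℝ) (hqin : ∀ i, Continuous (qin i))
    (qinit : Fin imax → Fin kmax → ℝ) :
    (∃ q I, IsSol a qstar β qin qinit q I) ∧
    ∀ q₁ I₁ q₂ I₂, IsSol a qstar β qin qinit q₁ I₁ → IsSol a qstar β qin qinit q₂ I₂ →
      ∀ t : ℝ, 0 ≤ t → q₁ t = q₂ t ∧ I₁ t = I₂ t := by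
  obtain ⟨K, hK⟩ := globallyLipschitz_augmentedField a qstar β qinit
  set f : ℝ → _ → _ := fun t x => augmentedField a qstar β qinit (fun j => qin j t, x)
  have hlip (t : ℝ) : LipschitzWith K (f t) := by
    simpa using! hK.comp (LipschitzWith.prodMk_left fun j => qin j t)
  have hcont (x) : Continuous fun t => f t x := hK.continuous.comp (by fun_prop)
  constructor
  · obtain ⟨γ, hγ0, hγ⟩ := exists_forall_hasDerivWithinAt_Ici_of_lipschitzWith hlip hcont
      (L := ‖a‖₊) (fun t x => norm_augmentedField_le ha qstar β qinit _) (qinit, 0)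
    exact ⟨fun t => (γ t).1, fun t => (γ t).2, isSol_iff.2 ⟨hγ0, hγ⟩⟩
  · intro q₁ I₁ q₂ I₂ h₁ h₂ t ht
    rw [isSol_iff] at h₁ h₂
    exact Prod.mk.inj (eqOn_Icc_of_hasDerivWithinAt_of_lipschitzWith hlip
      (fun s hs => (h₁.2 s hs.1).mono Set.Icc_subset_Ici_self)
      (fun s hs => (h₂.2 s hs.1).mono Set.Icc_subset_Ici_self)
      (h₁.1.trans h₂.1.symm) (Set.right_mem_Icc.2 ht))
end

section
/- Fix r* > 0, η > 0, β ∈ (0,1], α ≥ 0, and ε > 0. Define w(r, D⁻, D⁺) = α · w1(w2(r, D⁻, D⁺; η, β); r*) with w1(r; r*) = max{0, min{1, r/r*}} and w2(r, D⁻, D⁺; η, β) = min{r, (1/β)·max{ηD⁺ + r, 0}, (1/β)·max{ηD⁻ + r, 0}}, and define the flux Φ⁽¹⁾(ρ, σ, υ) = w(ρ, −σ + (ε/2)υ, σ + (ε/2)υ). Then for each fixed ρ and σ, the map υ ↦ Φ⁽¹⁾(ρ, σ, υ) is nondecreasing. Equivalently, the Hamiltonian H⁽¹⁾(P, ∇P,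 ∇²P) = −Φ⁽¹⁾(−∂_z P, ∂_x P, ∂²_x P) is degenerate elliptic (nonincreasing in the second-derivative argument ∂²_x P). -/
/-- Rescaled self-throttling function `w1(r; r*) = max{0, min{1, r/r*}}`. -/
noncomputable def w1 (r rstar : ℝ) : ℝ := max 0 (min 1 (r / rstar))

/-- Rescaled neighbor-throttling function
`w2(r, D⁻, D⁺; η, β) = min{r, (1/β)·max{ηD⁺ + r, 0}, (1/β)·max{ηD⁻ + r, 0}}`. -/
noncomputable def w2 (r Dm Dp η β : ℝ) : ℝ :=
  min r (min ((1 / β) * max (η * Dp + r) 0) ((1 / β) * max (η * Dm + r) 0))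

/-- Composite throttling function `w(r, D⁻, D⁺) = α · w1(w2(r, D⁻, D⁺; η, β); r*)`. -/
noncomputable def w (α r Dm Dp η β rstar : ℝ) : ℝ := α * w1 (w2 r Dm Dp η β) rstar

/-- Second-order flux `Φ⁽¹⁾(ρ, σ, υ) = w(ρ, −σ + (ε/2)υ, σ + (ε/2)υ)`. -/
noncomputable def Phi1 (ρ σ υ rstar α η β ε : ℝ) : ℝ :=
  w α ρ (-σ + (ε / 2) * υ) (σ + (ε / 2) * υ) η β rstar

theorem w1_mono {rstar : ℝ} (hrstar : 0 ≤ rstar) : Monotone fun r => w1 r rstar := by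
  intro a b hab
  simp only [w1]
  gcongr

theorem w2_le_w2 {η β : ℝ} (hη : 0 ≤ η) (hβ : 0 ≤ β) (r : ℝ) {Dm Dm' Dp Dp' : ℝ}
    (hm : Dm ≤ Dm') (hp : Dp ≤ Dp') : w2 r Dm Dp η β ≤ w2 r Dm' Dp' η β := by
  simp only [w2]
  gcongr

theorem Phi1_mono {rstar η β α ε : ℝ} (hrstar : 0 ≤ rstar) (hη : 0 ≤ η) (hβ : 0 ≤ β)
    (hα : 0 ≤ α) (hε : 0 ≤ ε) (ρ σ : ℝ) : Monotone fun υ => Phi1 ρ σ υ rstar α η β ε := by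
  intro a b hab
  simp only [Phi1, w]
  refine mul_le_mul_of_nonneg_left (w1_mono hrstar (w2_le_w2 hη hβ ρ ?_ ?_)) hα <;> gcongr

/-- For `r* > 0`, `η > 0`, `β ∈ (0,1]`, `α ≥ 0`, `ε > 0`, the flux
`Φ⁽¹⁾(ρ, σ, υ)` is nondecreasing in the second-derivative argument `υ` for each fixed `ρ, σ`;
equivalently, the Hamiltonian `H⁽¹⁾(P, ∇P, ∇²P) = −Φ⁽¹⁾(−∂_z P, ∂_x P, ∂²_x P)` is degenerate
elliptic (nonincreasing in `∂²_x P`). -/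
theorem stmt9 (rstar η β α ε : ℝ) (hrstar : 0 < rstar) (hη : 0 < η)
    (hβ : β ∈ Set.Ioc (0:ℝ) 1) (hα : 0 ≤ α) (hε : 0 < ε) :
    (∀ ρ σ : ℝ, Monotone fun υ => Phi1 ρ σ υ rstar α η β ε) ∧
    (∀ τ σ : ℝ, Antitone fun υ => -Phi1 (-τ) σ υ rstar α η β ε) := by
  exact ⟨Phi1_mono hrstar.le hη.le hβ.1.le hα hε.le,
    fun τ σ => (Phi1_mono hrstar.le hη.le hβ.1.le hα hε.le (-τ) σ).neg⟩
end

section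
/- Fix r* > 0, η > 0, β ∈ (0,1], and α ≥ 0, and let w(r, D⁻, D⁺) = α · w1(w2(r, D⁻, D⁺; η, β); r*) with w1(r; r*) = max{0, min{1, r/r*}} and w2(r, D⁻, D⁺; η, β) = min{r, (1/β)·max{ηD⁺ + r, 0}, (1/β)·max{ηD⁻ + r, 0}}. Then w is globally Lipschitz: for all real r, r̃, D⁻, D̃⁻, D⁺, D̃⁺, |w(r, D⁻, D⁺) − w(r̃, D̃⁻, D̃⁺)| ≤ (α/(β r*))·|r − r̃| + (αη/(β r*))·(|D⁻ − D̃⁻| + |D⁺ − D̃⁺|). In particular, the Lipschitz constant of w with respect to each of D⁻ and D⁺ is at most αη/(β r*), and with respect to r is at most α/(β r*). -/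
/-- The self-throttling function is `1 / r*`-Lipschitz. -/
theorem abs_w1_sub_w1_le {rstar : ℝ} (hrstar : 0 < rstar) (x y : ℝ) :
    |w1 x rstar - w1 y rstar| ≤ |x - y| / rstar := by
  unfold w1
  calc |max 0 (min 1 (x / rstar)) - max 0 (min 1 (y / rstar))|
      ≤ |min 1 (x / rstar) - min 1 (y / rstar)| := by
        simpa using abs_max_sub_max_le_max 0 (min 1 (x / rstar)) 0 (min 1 (y / rstar))
    _ ≤ |x / rstar - y / rstar| := by
        simpa using abs_min_sub_min_le_max 1 (x / rstar) 1 (y / rstar)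
    _ = |x - y| / rstar := by rw [← sub_div, abs_div, abs_of_pos hrstar]

theorem abs_inv_mul_max_sub_le {η β : ℝ} (hη : 0 < η) (hβ : 0 < β) (r r' D D' : ℝ) :
    |(1 / β) * max (η * D + r) 0 - (1 / β) * max (η * D' + r') 0| ≤
      (1 / β) * (|r - r'| + η * |D - D'|) := by
  rw [← mul_sub, abs_mul, abs_of_pos (one_div_pos.mpr hβ)]
  gcongr
  calc |max (η * D + r) 0 - max (η * D' + r') 0|
      ≤ |(η * D + r) - (η * D' + r')| := abs_max_sub_max_le_abs _ _ _
    _ = |(r - r') + η * (D - D')| := by ring_nf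
    _ ≤ |r - r'| + |η * (D - D')| := abs_add_le _ _
    _ = |r - r'| + η * |D - D'| := by rw [abs_mul, abs_of_pos hη]

/-- Lipschitz estimate for the neighbor-throttling function. -/
theorem abs_w2_sub_w2_le {η β : ℝ} (hη : 0 < η) (hβ : β ∈ Set.Ioc (0 : ℝ) 1)
    (r r' Dm Dm' Dp Dp' : ℝ) :
    |w2 r Dm Dp η β - w2 r' Dm' Dp' η β| ≤
      (1 / β) * (|r - r'| + η * (|Dm - Dm'| + |Dp - Dp'|)) := by
  obtain ⟨hβ0, hβ1⟩ := hβ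
  have hm : 0 ≤ |Dm - Dm'| := abs_nonneg _
  have hp : 0 ≤ |Dp - Dp'| := abs_nonneg _
  unfold w2
  refine (abs_min_sub_min_le_max _ _ _ _).trans (max_le ?_
    ((abs_min_sub_min_le_max _ _ _ _).trans (max_le ?_ ?_)))
  · calc |r - r'| ≤ (1 / β) * |r - r'| :=
          le_mul_of_one_le_left (abs_nonneg _) (one_le_one_div hβ0 hβ1)
      _ ≤ _ := by
          gcongr
          exact le_add_of_nonneg_right (by positivity)
  · refine (abs_inv_mul_max_sub_le hη hβ0 _ _ _ _).trans ?_
    gcongr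
    linarith
  · refine (abs_inv_mul_max_sub_le hη hβ0 _ _ _ _).trans ?_
    gcongr
    linarith

/-- The composite throttling function `w` is globally Lipschitz:
`|w(r, D⁻, D⁺) − w(r̃, D̃⁻, D̃⁺)| ≤ (α/(β r*))|r − r̃| + (αη/(β r*))(|D⁻ − D̃⁻| + |D⁺ − D̃⁺|)`;
in particular its Lipschitz constant with respect to each of `D⁻`, `D⁺` is at most
`αη/(β r*)` and with respect to `r` is at most `α/(β r*)`. -/
theorem stmt11 (rstar η β α : ℝ) (hrstar : 0 < rstar) (hη : 0 < η)
    (hβ : β ∈ Set.Ioc (0:ℝ) 1) (hα : 0 ≤ α) :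
    (∀ r r' Dm Dm' Dp Dp' : ℝ,
      |w α r Dm Dp η β rstar - w α r' Dm' Dp' η β rstar| ≤
        α / (β * rstar) * |r - r'| + α * η / (β * rstar) * (|Dm - Dm'| + |Dp - Dp'|)) ∧
    (∀ r Dm Dm' Dp : ℝ,
      |w α r Dm Dp η β rstar - w α r Dm' Dp η β rstar| ≤ α * η / (β * rstar) * |Dm - Dm'|) ∧
    (∀ r Dm Dp Dp' : ℝ,
      |w α r Dm Dp η β rstar - w α r Dm Dp' η β rstar| ≤ α * η / (β * rstar) * |Dp - Dp'|) ∧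
    (∀ r r' Dm Dp : ℝ,
      |w α r Dm Dp η β rstar - w α r' Dm Dp η β rstar| ≤ α / (β * rstar) * |r - r'|) := by
  have main (r r' Dm Dm' Dp Dp' : ℝ) :
      |w α r Dm Dp η β rstar - w α r' Dm' Dp' η β rstar| ≤
        α / (β * rstar) * |r - r'| + α * η / (β * rstar) * (|Dm - Dm'| + |Dp - Dp'|) := by
    have hβ0 : 0 < β := hβ.1
    unfold w
    rw [← mul_sub, abs_mul, abs_of_nonneg hα]
    calc α * |w1 (w2 r Dm Dp η β) rstar - w1 (w2 r' Dm' Dp' η β) rstar|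
        ≤ α * (|w2 r Dm Dp η β - w2 r' Dm' Dp' η β| / rstar) := by
          gcongr
          exact abs_w1_sub_w1_le hrstar _ _
      _ ≤ α * ((1 / β) * (|r - r'| + η * (|Dm - Dm'| + |Dp - Dp'|)) / rstar) := by
          gcongr
          exact abs_w2_sub_w2_le hη hβ _ _ _ _ _ _
      _ = _ := by
          field_simp
  refine ⟨main, fun r Dm Dm' Dp => ?_, fun r Dm Dp Dp' => ?_, fun r r' Dm Dp => ?_⟩
  · simpa using main r r Dm Dm' Dp Dp
  · simpa using main r r Dm Dm Dp Dp'
  · simpa using main r r' Dm Dm Dp Dp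
end
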